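/- arXiv:2208.14709 — 2 statements merged into one kernel-verified Lean document; each statement's English description precedes it below -/
import Mathlib

section
/- (Existence of the Maxwell stress function, n = 3.) Let σ : ℝ³ → (3×3 real matrices) be a smooth matrix-valued field that is symmetric at every point (σᵢⱼ = σⱼᵢ) and divergence-free (for each i, Σⱼ ∂ⱼσᵢⱼ = 0 everywhere). Then there exist smooth functions Φ₁₁, Φ₂₂, Φ₃₃ : ℝ³ → ℝ such that everywhere on ℝ³: σ₁₁ = ∂₂∂₂Φ₃₃ + ∂₃∂₃Φ₂₂, σ₂₂ = ∂₁∂₁Φ₃₃ + ∂₃∂₃Φ₁₁, σ₃₃ = ∂₁∂₁Φ₂₂ + ∂₂∂₂Φ₁₁, σ₁₂ = −∂₁∂₂Φ₃₃, σ₁₃ = −∂₁∂₃Φ₂₂, and σ₂₃ = −∂₂∂₃Φ₁₁. -/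
open Finset

/-- The `i`-th partial derivative of a function on `ℝ³`. -/
noncomputable def pd3 (i : Fin 3) (f : (Fin 3 → ℝ) → ℝ) : (Fin 3 → ℝ) → ℝ :=
  fun x => fderiv ℝ f x (Pi.single i 1)

open scoped ContDiff

/-- A parametric interval integral of a `C^n` function is `C^n` in the parameter. -/
theorem contDiff_parametric_intervalIntegral_nat {H : Type} [NormedAddCommGroup H]
    [NormedSpace ℝ H] [FiniteDimensional ℝ H] (n : ℕ) (a b : ℝ) :
    ∀ {E : Type} [NormedAddCommGroup E] [NormedSpace ℝ E] {F : H × ℝ → E},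
      ContDiff ℝ n F → ContDiff ℝ n (fun x => ∫ t in a..b, F (x, t)) := by
  have : ProperSpace H := FiniteDimensional.proper ℝ H
  induction n with
  | zero =>
    intro E _ _ F hF
    simp only [CharP.cast_eq_zero, contDiff_zero] at hF ⊢
    exact intervalIntegral.continuous_parametric_intervalIntegral_of_continuous'
      (f := fun x t => F (x, t)) hF a b
  | succ n ih =>
    intro E _ _ F hF
    have hdF : ContDiff ℝ n
        (fun p : H × ℝ => (fderiv ℝ F p).comp (ContinuousLinearMap.inl ℝ H ℝ)) :=
      (hF.fderiv_right (by norm_cast)).clm_comp contDiff_const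
    have hderiv : ∀ x, HasFDerivAt (fun x => ∫ t in a..b, F (x, t))
        (∫ t in a..b, (fderiv ℝ F (x, t)).comp (ContinuousLinearMap.inl ℝ H ℝ)) x := by
      intro x
      obtain ⟨C, hC⟩ := ((isCompact_closedBall x 1).prod
        (isCompact_uIcc (a := a) (b := b))).exists_bound_of_continuousOn
          hdF.continuous.continuousOn
      refine intervalIntegral.hasFDerivAt_integral_of_dominated_of_fderiv_le
        (F := fun x t => F (x, t)) (bound := fun _ => C)
        (F' := fun x t => (fderiv ℝ F (x, t)).comp (ContinuousLinearMap.inl ℝ H ℝ))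
        (Metric.closedBall_mem_nhds x one_pos) ?_ ?_ ?_ ?_ ?_ ?_
      · exact .of_forall fun y =>
          (hF.continuous.comp (Continuous.prodMk_right y)).aestronglyMeasurable
      · exact (hF.continuous.comp (Continuous.prodMk_right x)).intervalIntegrable _ _
      · exact (hdF.continuous.comp (Continuous.prodMk_right x)).aestronglyMeasurable
      · exact .of_forall fun t ht y hy => hC (y, t) ⟨hy, Set.uIoc_subset_uIcc ht⟩
      · exact intervalIntegrable_const
      · refine .of_forall fun t _ y _ => ?_
        have hdiff : DifferentiableAt ℝ F (y, t) :=
          (hF.differentiable (by norm_cast)).differentiableAt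
        exact hdiff.hasFDerivAt.comp y (hasFDerivAt_prodMk_left y t)
    push_cast
    refine contDiff_succ_iff_fderiv.2 ⟨fun x => (hderiv x).differentiableAt, by simp, ?_⟩
    rw [funext fun x => (hderiv x).fderiv]
    exact ih hdF

/-- A parametric interval integral of a smooth function is smooth in the parameter. -/
theorem contDiff_parametric_intervalIntegral {H : Type} [NormedAddCommGroup H]
    [NormedSpace ℝ H] [FiniteDimensional ℝ H] {E : Type} [NormedAddCommGroup E]
    [NormedSpace ℝ E] {F : H × ℝ → E} (hF : ContDiff ℝ ∞ F) (a b : ℝ) :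
    ContDiff ℝ ∞ (fun x => ∫ t in a..b, F (x, t)) :=
  contDiff_infty.2 fun n => contDiff_parametric_intervalIntegral_nat n a b (contDiff_infty.1 hF n)

theorem contDiff_pd3 {f : (Fin 3 → ℝ) → ℝ} (hf : ContDiff ℝ ∞ f) (i : Fin 3) :
    ContDiff ℝ ∞ (pd3 i f) :=
  (hf.fderiv_right (by simp)).clm_apply contDiff_const

theorem pd3_comm {f : (Fin 3 → ℝ) → ℝ} (hf : ContDiff ℝ ∞ f) (i j : Fin 3) :
    pd3 i (pd3 j f) = pd3 j (pd3 i f) := by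
  have hdf : Differentiable ℝ (fderiv ℝ f) :=
    (hf.fderiv_right (m := ∞) (by simp)).differentiable (by simp)
  have hsnd : ∀ i j : Fin 3, ∀ x,
      pd3 i (pd3 j f) x = fderiv ℝ (fderiv ℝ f) x (Pi.single i 1) (Pi.single j 1) := by
    intro i j x
    unfold pd3
    rw [fderiv_clm_apply (hdf x) (differentiableAt_const _)]
    simp
  ext x
  rw [hsnd, hsnd]
  exact hf.contDiffAt.isSymmSndFDerivAt (by simpa using WithTop.coe_le_coe.2 (le_top (a := (2 : ℕ∞)))) _ _

theorem pd3_add {f g : (Fin 3 → ℝ) → ℝ} (hf : ContDiff ℝ ∞ f) (hg : ContDiff ℝ ∞ g)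
    (i : Fin 3) : pd3 i (f + g) = pd3 i f + pd3 i g := by
  ext x
  simp [pd3, fderiv_add (hf.differentiable (by simp) x) (hg.differentiable (by simp) x)]

theorem pd3_neg (f : (Fin 3 → ℝ) → ℝ) (i : Fin 3) : pd3 i (-f) = -pd3 i f := by
  ext x
  simp [pd3, fderiv_neg]

theorem pd3_zero (i : Fin 3) : pd3 i 0 = 0 := by
  ext x
  simp [pd3]

theorem hasDerivAt_line_pd3 {f : (Fin 3 → ℝ) → ℝ} (hf : ContDiff ℝ ∞ f) (i : Fin 3)
    (x : Fin 3 → ℝ) (t : ℝ) :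
    HasDerivAt (fun h : ℝ => f (x + h • Pi.single i 1)) (pd3 i f (x + t • Pi.single i 1)) t := by
  have hline : HasDerivAt (fun h : ℝ => x + h • (Pi.single i 1 : Fin 3 → ℝ))
      (Pi.single i 1) t := by
    simpa using ((hasDerivAt_id t).smul_const (Pi.single i 1 : Fin 3 → ℝ)).const_add x
  exact (hf.differentiable (by simp) _).hasFDerivAt.comp_hasDerivAt t hline

theorem pd3_eq_zero_iff {f : (Fin 3 → ℝ) → ℝ} (hf : ContDiff ℝ ∞ f) (i : Fin 3) :
    pd3 i f = 0 ↔ ∀ x, ∀ h : ℝ, f (x + h • Pi.single i 1) = f x := by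
  constructor
  · intro hzero x h
    have hd := fun t => hasDerivAt_line_pd3 hf i x t
    simp only [hzero, Pi.zero_apply] at hd
    simpa using is_const_of_deriv_eq_zero (fun t => (hd t).differentiableAt)
      (fun t => (hd t).deriv) h 0
  · intro hconst
    ext x
    have hd := hasDerivAt_line_pd3 hf i x 0
    simp only [hconst, zero_smul, add_zero] at hd
    exact hd.unique (hasDerivAt_const 0 (f x))

/-- A smooth function has a smooth antiderivative in each coordinate, which does not depend on
the other coordinates that the function does not depend on. -/
theorem exists_pd3_antiderivative {f : (Fin 3 → ℝ) → ℝ} (hf : ContDiff ℝ ∞ f) (i : Fin 3) :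
    ∃ F : (Fin 3 → ℝ) → ℝ, ContDiff ℝ ∞ F ∧ pd3 i F = f ∧
      ∀ j, j ≠ i → pd3 j f = 0 → pd3 j F = 0 := by
  set e : Fin 3 → ℝ := Pi.single i 1 with he
  set F : (Fin 3 → ℝ) → ℝ := fun x => ∫ s in (0 : ℝ)..1, x i * f (x + ((s - 1) * x i) • e)
    with hF
  have hFsmooth : ContDiff ℝ ∞ F := by
    refine contDiff_parametric_intervalIntegral
      (F := fun p : (Fin 3 → ℝ) × ℝ => p.1 i * f (p.1 + ((p.2 - 1) * p.1 i) • e)) ?_ 0 1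
    fun_prop
  refine ⟨F, hFsmooth, ?_, ?_⟩
  · ext x
    have hline : ∀ h : ℝ, F (x + h • e) = ∫ u in (0 : ℝ)..(x i + h), f (x + (u - x i) • e) := by
      intro h
      have hi : (x + h • e) i = x i + h := by simp [he]
      have hsubst := intervalIntegral.mul_integral_comp_mul_right (a := 0) (b := 1) (c := x i + h)
        (f := fun u => f (x + (u - x i) • e))
      simp only [zero_mul, one_mul] at hsubst
      rw [← hsubst, ← intervalIntegral.integral_const_mul]
      simp only [hF, hi]
      congr! 4 with s
      module
    have hcont : Continuous fun u : ℝ => f (x + (u - x i) • e) :=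
      hf.continuous.comp (by fun_prop)
    have hftc : HasDerivAt (fun h : ℝ => F (x + h • e)) (f x) 0 := by
      rw [funext hline]
      have hint := hcont.integral_hasStrictDerivAt 0 (x i + 0)
      simpa using hint.hasDerivAt.comp_const_add (x i) 0
    simpa using (hasDerivAt_line_pd3 hFsmooth i x 0).unique hftc
  · intro j hji hzero
    rw [pd3_eq_zero_iff hf] at hzero
    rw [pd3_eq_zero_iff hFsmooth]
    intro x h
    have hi : (x + h • (Pi.single j 1 : Fin 3 → ℝ)) i = x i := by simp [hji.symm]
    simp only [hF, hi]
    congr! 3 with s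
    rw [add_right_comm, hzero]

/-- Every smooth function is a second partial derivative `∂ᵢ∂ⱼF` of a smooth function `F`, which
does not depend on the further coordinates that the given function does not depend on. -/
theorem exists_pd3_pd3_eq {f : (Fin 3 → ℝ) → ℝ} (hf : ContDiff ℝ ∞ f) (i j : Fin 3) :
    ∃ F : (Fin 3 → ℝ) → ℝ, ContDiff ℝ ∞ F ∧ pd3 i (pd3 j F) = f ∧
      ∀ k, k ≠ i → k ≠ j → pd3 k f = 0 → pd3 k F = 0 := by
  obtain ⟨G, hG, hGf, hGk⟩ := exists_pd3_antiderivative hf i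
  obtain ⟨F, hF, hFG, hFk⟩ := exists_pd3_antiderivative hG j
  exact ⟨F, hF, by rw [hFG, hGf], fun k hki hkj hk => hFk k hkj (hGk k hki hk)⟩

/-- If the row `(s, -∂ᵢ∂ⱼC, -∂ᵢ∂ₖB)` is divergence-free, then `s - ∂ⱼ∂ⱼC - ∂ₖ∂ₖB` does not depend
on the `i`-th coordinate, so it is a pure second derivative `∂ₗ∂ₗD` with `D` independent of the
`i`-th coordinate. -/
theorem exists_pd3_correction {s C B : (Fin 3 → ℝ) → ℝ} (hs : ContDiff ℝ ∞ s)
    (hC : ContDiff ℝ ∞ C) (hB : ContDiff ℝ ∞ B) {i j k l : Fin 3} (hil : i ≠ l)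
    (hdiv : pd3 i s + -pd3 j (pd3 i (pd3 j C)) + -pd3 k (pd3 i (pd3 k B)) = 0) :
    ∃ D : (Fin 3 → ℝ) → ℝ, ContDiff ℝ ∞ D ∧ pd3 i D = 0 ∧
      s = pd3 j (pd3 j C) + pd3 k (pd3 k B) + pd3 l (pd3 l D) := by
  have hCj := contDiff_pd3 hC j
  have hBk := contDiff_pd3 hB k
  have hCjj := contDiff_pd3 hCj j
  have hBkk := contDiff_pd3 hBk k
  have hCneg : ContDiff ℝ ∞ (-pd3 j (pd3 j C)) := hCjj.neg
  have hBneg : ContDiff ℝ ∞ (-pd3 k (pd3 k B)) := hBkk.neg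
  have hsC : ContDiff ℝ ∞ (s + -pd3 j (pd3 j C)) := hs.add hCneg
  have hr : ContDiff ℝ ∞ (s + -pd3 j (pd3 j C) + -pd3 k (pd3 k B)) := hsC.add hBneg
  obtain ⟨D, hD, hDr, hDi⟩ := exists_pd3_pd3_eq hr l l
  refine ⟨D, hD, hDi i hil hil ?_, ?_⟩
  · rw [pd3_add hsC hBneg, pd3_add hs hCneg, pd3_neg, pd3_neg,
      pd3_comm hCj i j, pd3_comm hBk i k, hdiv]
  · rw [hDr]
    abel

/-- Existence of the Maxwell stress function: if `σ` is a smooth, symmetric, divergence-free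
Cauchy stress field on `ℝ³` (given by its component functions `σ i j`), then there are smooth
functions `Φ₁₁, Φ₂₂, Φ₃₃` such that
`σ₁₁ = ∂₂∂₂Φ₃₃ + ∂₃∂₃Φ₂₂`, `σ₂₂ = ∂₁∂₁Φ₃₃ + ∂₃∂₃Φ₁₁`, `σ₃₃ = ∂₁∂₁Φ₂₂ + ∂₂∂₂Φ₁₁`,
`σ₁₂ = −∂₁∂₂Φ₃₃`, `σ₁₃ = −∂₁∂₃Φ₂₂`, `σ₂₃ = −∂₂∂₃Φ₁₁`. -/
theorem exists_maxwell_stress_function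
    (σ : Fin 3 → Fin 3 → (Fin 3 → ℝ) → ℝ)
    (hsmooth : ∀ i j, ContDiff ℝ (⊤ : ℕ∞) (σ i j))
    (hsymm : ∀ i j, ∀ x, σ i j x = σ j i x)
    (hdiv : ∀ i, ∀ x, ∑ j, pd3 j (σ i j) x = 0) :
    ∃ Φ₁₁ Φ₂₂ Φ₃₃ : (Fin 3 → ℝ) → ℝ,
      ContDiff ℝ (⊤ : ℕ∞) Φ₁₁ ∧ ContDiff ℝ (⊤ : ℕ∞) Φ₂₂ ∧ ContDiff ℝ (⊤ : ℕ∞) Φ₃₃ ∧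
      (∀ x, σ 0 0 x = pd3 1 (pd3 1 Φ₃₃) x + pd3 2 (pd3 2 Φ₂₂) x) ∧
      (∀ x, σ 1 1 x = pd3 0 (pd3 0 Φ₃₃) x + pd3 2 (pd3 2 Φ₁₁) x) ∧
      (∀ x, σ 2 2 x = pd3 0 (pd3 0 Φ₂₂) x + pd3 1 (pd3 1 Φ₁₁) x) ∧
      (∀ x, σ 0 1 x = -pd3 0 (pd3 1 Φ₃₃) x) ∧
      (∀ x, σ 0 2 x = -pd3 0 (pd3 2 Φ₂₂) x) ∧
      (∀ x, σ 1 2 x = -pd3 1 (pd3 2 Φ₁₁) x) := by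
  have hrow : ∀ i, pd3 0 (σ i 0) + pd3 1 (σ i 1) + pd3 2 (σ i 2) = 0 := by
    intro i
    ext x
    simpa [Fin.sum_univ_three] using hdiv i x
  have hsym : ∀ i j, σ i j = σ j i := fun i j => funext (hsymm i j)
  obtain ⟨A, hA, hAσ, -⟩ := exists_pd3_pd3_eq (hsmooth 1 2).neg 1 2
  obtain ⟨B, hB, hBσ, -⟩ := exists_pd3_pd3_eq (hsmooth 0 2).neg 0 2
  obtain ⟨C, hC, hCσ, -⟩ := exists_pd3_pd3_eq (hsmooth 0 1).neg 0 1
  change _ = -σ 1 2 at hAσ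
  change _ = -σ 0 2 at hBσ
  change _ = -σ 0 1 at hCσ
  have hAσ' : pd3 2 (pd3 1 A) = -σ 1 2 := by rw [pd3_comm hA, hAσ]
  have hBσ' : pd3 2 (pd3 0 B) = -σ 0 2 := by rw [pd3_comm hB, hBσ]
  have hCσ' : pd3 1 (pd3 0 C) = -σ 0 1 := by rw [pd3_comm hC, hCσ]
  obtain ⟨c, hc, hc0, hσ0⟩ := exists_pd3_correction (i := 0) (j := 1) (k := 2) (l := 1)
    (hsmooth 0 0) hC hB (by decide) (by
      rw [hCσ, hBσ, pd3_neg, pd3_neg, neg_neg, neg_neg, hrow 0])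
  obtain ⟨a, ha, ha1, hσ1⟩ := exists_pd3_correction (i := 1) (j := 0) (k := 2) (l := 2)
    (hsmooth 1 1) hC hA (by decide) (by
      rw [hCσ', hAσ, pd3_neg, pd3_neg, neg_neg, neg_neg, ← hrow 1, hsym 1 0]
      abel)
  obtain ⟨b, hb, hb2, hσ2⟩ := exists_pd3_correction (i := 2) (j := 0) (k := 1) (l := 0)
    (hsmooth 2 2) hB hA (by decide) (by
      rw [hBσ', hAσ', pd3_neg, pd3_neg, neg_neg, neg_neg, ← hrow 2, hsym 2 0, hsym 2 1]
      abel)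
  have hadd : ∀ {f g : (Fin 3 → ℝ) → ℝ}, ContDiff ℝ ∞ f → ContDiff ℝ ∞ g → ∀ i j,
      pd3 i (pd3 j (f + g)) = pd3 i (pd3 j f) + pd3 i (pd3 j g) := by
    intro f g hf hg i j
    rw [pd3_add hf hg, pd3_add (contDiff_pd3 hf j) (contDiff_pd3 hg j)]
  refine ⟨A + a, B + b, C + c, hA.add ha, hB.add hb, hC.add hc, ?_, ?_, ?_, ?_, ?_, ?_⟩ <;>
    intro x
  · rw [hadd hC hc, hadd hB hb, hb2, pd3_zero, hσ0]
    simp only [Pi.add_apply, Pi.zero_apply]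
    ring
  · rw [hadd hC hc, hadd hA ha, hc0, pd3_zero, hσ1]
    simp only [Pi.add_apply, Pi.zero_apply]
    ring
  · rw [hadd hB hb, hadd hA ha, ha1, pd3_zero, hσ2]
    simp only [Pi.add_apply, Pi.zero_apply]
    ring
  · rw [hadd hC hc, hCσ, pd3_comm hc, hc0, pd3_zero]
    simp
  · rw [hadd hB hb, hBσ, hb2, pd3_zero]
    simp
  · rw [hadd hA ha, hAσ, pd3_comm ha, ha1, pd3_zero]
    simp
end

section
/- (Gauge-fixed primitive of a closed 2-form on ℝ³.) Let a, b, c : ℝ³ → ℝ be smooth functions satisfying ∂₃a − ∂₂b + ∂₁c = 0 at every point of ℝ³ (closedness of the 2-form a dx₁∧dx₂ + b dx₁∧dx₃ + c dx₂∧dx₃). Then there exist smooth functions f, g : ℝ³ → ℝ such that the 1-form f dx₁ + 0·dx₂ + g dx₃, whose dx₂-component vanishes identically, is a primitive of the given 2-form; explicitly, a = −∂₂f, b = ∂₁g − ∂₃f, and c = ∂₂g everywhere on ℝ³. -/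
open MeasureTheory

/-- Differentiation under the integral sign for an integrand that is jointly `C¹`. -/
theorem hasFDerivAt_intervalIntegral_of_contDiff
    {E F : Type*} [NormedAddCommGroup E] [NormedSpace ℝ E] [ProperSpace E]
    [NormedAddCommGroup F] [NormedSpace ℝ F]
    {H : E → ℝ → F} (hH : ContDiff ℝ 1 (Function.uncurry H)) (l r : ℝ) (x : E) :
    HasFDerivAt (fun y => ∫ t in l..r, H y t)
      (∫ t in l..r, fderiv ℝ (fun y => H y t) x) x := by
  have hcont : Continuous fun p : E × ℝ => fderiv ℝ (fun y => H y p.2) p.1 := by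
    have hswap : ContDiff ℝ 1 (Function.uncurry fun (p : E × ℝ) (y : E) => H y p.2) :=
      hH.comp (contDiff_snd.prodMk (contDiff_snd.comp contDiff_fst))
    exact (hswap.fderiv (n := 0) contDiff_fst (by simp)).continuous
  have hcurry (y : E) : Continuous (H y) := hH.continuous.comp (Continuous.prodMk_right y)
  obtain ⟨C, hC⟩ := ((isCompact_closedBall x 1).prod
    (isCompact_uIcc (a := l) (b := r))).exists_bound_of_continuousOn hcont.continuousOn
  refine intervalIntegral.hasFDerivAt_integral_of_dominated_of_fderiv_le (bound := fun _ => C)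
    (F' := fun y t => fderiv ℝ (fun z => H z t) y)
    (Metric.closedBall_mem_nhds x one_pos) (.of_forall fun y => (hcurry y).aestronglyMeasurable)
    ((hcurry x).intervalIntegrable _ _) ?_ ?_ (by simp) ?_
  · exact (hcont.comp (Continuous.prodMk_right x)).aestronglyMeasurable
  · exact .of_forall fun t ht y hy => hC (y, t) ⟨hy, Set.uIoc_subset_uIcc ht⟩
  · refine .of_forall fun t _ y _ => DifferentiableAt.hasFDerivAt ?_
    have : ContDiff ℝ 1 fun z => H z t := hH.comp (contDiff_id.prodMk contDiff_const)
    exact this.differentiable (by simp) y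

universe u

theorem contDiff_nat_intervalIntegral {E : Type u} [NormedAddCommGroup E] [NormedSpace ℝ E]
    [ProperSpace E] (l r : ℝ) (n : ℕ) :
    ∀ {F : Type u} [NormedAddCommGroup F] [NormedSpace ℝ F] {H : E → ℝ → F},
      ContDiff ℝ n (Function.uncurry H) → ContDiff ℝ n fun y => ∫ t in l..r, H y t := by
  induction n with
  | zero =>
    intro F _ _ H hH
    exact contDiff_zero.2 (intervalIntegral.continuous_parametric_intervalIntegral_of_continuous'
      hH.continuous l r)
  | succ n ih =>
    intro F _ _ H hH
    rw [Nat.cast_succ] at hH ⊢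
    refine contDiff_succ_iff_hasFDerivAt.2
      ⟨fun x => ∫ t in l..r, fderiv ℝ (fun y => H y t) x, ih ?_, fun x =>
        hasFDerivAt_intervalIntegral_of_contDiff (hH.of_le (by simp)) l r x⟩
    have hswap : ContDiff ℝ (n + 1)
        (Function.uncurry fun (p : E × ℝ) (y : E) => H y p.2) :=
      hH.comp (contDiff_snd.prodMk (contDiff_snd.comp contDiff_fst))
    exact hswap.fderiv contDiff_fst le_rfl

/-- An integral of a smooth function depends smoothly on parameters. -/
theorem contDiff_infty_intervalIntegral {E F : Type u} [NormedAddCommGroup E] [NormedSpace ℝ E]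
    [ProperSpace E] [NormedAddCommGroup F] [NormedSpace ℝ F] {H : E → ℝ → F}
    (hH : ContDiff ℝ (⊤ : ℕ∞) (Function.uncurry H)) (l r : ℝ) :
    ContDiff ℝ (⊤ : ℕ∞) fun y => ∫ t in l..r, H y t :=
  contDiff_infty.2 fun n => contDiff_nat_intervalIntegral l r n (contDiff_infty.1 hH n)

theorem ContDiff.update {E ι : Type*} [NormedAddCommGroup E] [NormedSpace ℝ E] [Fintype ι]
    [DecidableEq ι] {n : WithTop ℕ∞} {f : E → ι → ℝ} {g : E → ℝ} (hf : ContDiff ℝ n f)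
    (hg : ContDiff ℝ n g) (i : ι) : ContDiff ℝ n fun x => Function.update (f x) i (g x) := by
  refine contDiff_pi.2 fun j => ?_
  rcases eq_or_ne j i with rfl | hij
  · simpa using hg
  · simpa [hij] using contDiff_pi.1 hf j

/-- The primitive of `u` in the `i`-th coordinate that vanishes on the hyperplane `xᵢ = 0`. -/
noncomputable def coordPrimitive (i : Fin 3) (u : (Fin 3 → ℝ) → ℝ) (x : Fin 3 → ℝ) : ℝ :=
  ∫ s in (0 : ℝ)..x i, u (Function.update x i s)

theorem contDiff_coordPrimitive {u : (Fin 3 → ℝ) → ℝ} (hu : ContDiff ℝ (⊤ : ℕ∞) u) (i : Fin 3) :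
    ContDiff ℝ (⊤ : ℕ∞) (coordPrimitive i u) := by
  have heq : coordPrimitive i u =
      fun x => x i * ∫ t in (0 : ℝ)..1, u (Function.update x i (x i * t)) := by
    funext x
    rw [intervalIntegral.mul_integral_comp_mul_left (f := fun s => u (Function.update x i s))]
    simp [coordPrimitive]
  rw [heq]
  refine (contDiff_apply ℝ ℝ i).mul (contDiff_infty_intervalIntegral ?_ 0 1)
  exact hu.comp
    (contDiff_fst.update (((contDiff_apply ℝ ℝ i).comp contDiff_fst).mul contDiff_snd) i)

theorem hasDerivAt_comp_update {u : (Fin 3 → ℝ) → ℝ} (hu : Differentiable ℝ u) (i : Fin 3)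
    (x : Fin 3 → ℝ) (t : ℝ) :
    HasDerivAt (fun s => u (Function.update x i s)) (pd3 i u (Function.update x i t)) t :=
  (hu _).hasFDerivAt.comp_hasDerivAt t (hasDerivAt_update x i t)

theorem pd3_eq_of_hasDerivAt {u : (Fin 3 → ℝ) → ℝ} (hu : Differentiable ℝ u) {i : Fin 3}
    {x : Fin 3 → ℝ} {d : ℝ} (h : HasDerivAt (fun s => u (Function.update x i s)) d (x i)) :
    pd3 i u x = d := by
  simpa using (hasDerivAt_comp_update hu i x (x i)).unique h

theorem pd3_coordPrimitive_self {u : (Fin 3 → ℝ) → ℝ} (hu : ContDiff ℝ (⊤ : ℕ∞) u) (i : Fin 3)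
    (x : Fin 3 → ℝ) : pd3 i (coordPrimitive i u) x = u x := by
  refine pd3_eq_of_hasDerivAt ((contDiff_coordPrimitive hu i).differentiable (by simp)) ?_
  have hcont : Continuous fun s => u (Function.update x i s) :=
    hu.continuous.comp (by fun_prop)
  simpa [coordPrimitive] using hcont.integral_hasStrictDerivAt 0 (x i) |>.hasDerivAt

theorem pd3_coordPrimitive_of_ne {u : (Fin 3 → ℝ) → ℝ} (hu : ContDiff ℝ (⊤ : ℕ∞) u)
    {i j : Fin 3} (hij : i ≠ j) (x : Fin 3 → ℝ) :
    pd3 j (coordPrimitive i u) x = coordPrimitive i (pd3 j u) x := by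
  refine pd3_eq_of_hasDerivAt ((contDiff_coordPrimitive hu i).differentiable (by simp)) ?_
  have hH : ContDiff ℝ 1 (Function.uncurry fun t s : ℝ =>
      u (Function.update (Function.update x j t) i s)) :=
    (hu.of_le (by exact_mod_cast le_top)).comp
      ((contDiff_const.update contDiff_fst j).update contDiff_snd i)
  have hint : IntervalIntegrable (fun s => fderiv ℝ (fun t =>
      u (Function.update (Function.update x j t) i s)) (x j)) volume 0 (x i) := by
    have hswap : ContDiff ℝ 1 (Function.uncurry fun s t : ℝ =>
        u (Function.update (Function.update x j t) i s)) :=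
      hH.comp (contDiff_snd.prodMk contDiff_fst)
    exact (hswap.fderiv (n := 0) contDiff_const (by simp)).continuous.intervalIntegrable _ _
  have h := (hasFDerivAt_intervalIntegral_of_contDiff hH 0 (x i) (x j)).hasDerivAt
  rw [ContinuousLinearMap.intervalIntegral_apply hint] at h
  have hfun : (fun t => coordPrimitive i u (Function.update x j t)) =
      fun t => ∫ s in (0 : ℝ)..x i, u (Function.update (Function.update x j t) i s) := by
    funext t
    simp [coordPrimitive, hij]
  rw [hfun]
  refine h.congr_deriv (intervalIntegral.integral_congr fun s _ => ?_)
  have h' := hasDerivAt_comp_update (hu.differentiable (by simp)) j (Function.update x i s) (x j)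
  simp only [Function.update_comm hij.symm, fderiv_apply_one_eq_deriv]
  rw [h'.deriv, Function.update_comm hij, Function.update_eq_self]

theorem continuous_pd3 {u : (Fin 3 → ℝ) → ℝ} (hu : ContDiff ℝ (⊤ : ℕ∞) u) (i : Fin 3) :
    Continuous (pd3 i u) :=
  (hu.continuous_fderiv (by simp)).clm_apply continuous_const

theorem coordPrimitive_pd3_self {u : (Fin 3 → ℝ) → ℝ} (hu : ContDiff ℝ (⊤ : ℕ∞) u) (i : Fin 3)
    (x : Fin 3 → ℝ) : coordPrimitive i (pd3 i u) x = u x - u (Function.update x i 0) := by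
  rw [coordPrimitive, intervalIntegral.integral_eq_sub_of_hasDerivAt
    (fun t _ => hasDerivAt_comp_update (hu.differentiable (by simp)) i x t)
    (((continuous_pd3 hu i).comp (by fun_prop)).intervalIntegrable _ _), Function.update_eq_self]

theorem coordPrimitive_add {u v : (Fin 3 → ℝ) → ℝ} (hu : Continuous u) (hv : Continuous v)
    (i : Fin 3) (x : Fin 3 → ℝ) :
    coordPrimitive i (u + v) x = coordPrimitive i u x + coordPrimitive i v x :=
  intervalIntegral.integral_add ((hu.comp (by fun_prop)).intervalIntegrable _ _)
    ((hv.comp (by fun_prop)).intervalIntegrable _ _)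

/-- Gauge-fixed primitive of a closed 2-form on `ℝ³`: if the smooth functions `a, b, c`
satisfy `∂₃a − ∂₂b + ∂₁c = 0` everywhere (closedness of the 2-form
`a dx₁∧dx₂ + b dx₁∧dx₃ + c dx₂∧dx₃`), then there are smooth functions `f, g` such that the
1-form `f dx₁ + 0·dx₂ + g dx₃` is a primitive of it: `a = −∂₂f`, `b = ∂₁g − ∂₃f`,
`c = ∂₂g` everywhere. -/
theorem exists_gauge_fixed_primitive
    (a b c : (Fin 3 → ℝ) → ℝ)
    (ha : ContDiff ℝ (⊤ : ℕ∞) a) (hb : ContDiff ℝ (⊤ : ℕ∞) b) (hc : ContDiff ℝ (⊤ : ℕ∞) c)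
    (hclosed : ∀ x, pd3 2 a x - pd3 1 b x + pd3 0 c x = 0) :
    ∃ f g : (Fin 3 → ℝ) → ℝ, ContDiff ℝ (⊤ : ℕ∞) f ∧ ContDiff ℝ (⊤ : ℕ∞) g ∧
      (∀ x, a x = -pd3 1 f x) ∧
      (∀ x, b x = pd3 0 g x - pd3 2 f x) ∧
      (∀ x, c x = pd3 1 g x) := by
  set b₀ : (Fin 3 → ℝ) → ℝ := fun x => b (Function.update x 1 0) with hb₀_def
  have hb₀ : ContDiff ℝ (⊤ : ℕ∞) b₀ := hb.comp (contDiff_id.update contDiff_const 1)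
  have hA := contDiff_coordPrimitive ha 1
  have hB := contDiff_coordPrimitive hb₀ 2
  have hpd (i : Fin 3) (x : Fin 3 → ℝ) :
      pd3 i (fun y => -coordPrimitive 1 a y - coordPrimitive 2 b₀ y) x =
        -pd3 i (coordPrimitive 1 a) x - pd3 i (coordPrimitive 2 b₀) x := by
    have hA' := (hA.differentiable (by simp) x).hasFDerivAt
    have hB' := (hB.differentiable (by simp) x).hasFDerivAt
    simp [pd3, (hA'.fun_neg.fun_sub hB').fderiv]
  refine ⟨fun y => -coordPrimitive 1 a y - coordPrimitive 2 b₀ y, coordPrimitive 1 c,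
    hA.neg.sub hB, contDiff_coordPrimitive hc 1, fun x => ?_, fun x => ?_,
    fun x => (pd3_coordPrimitive_self hc 1 x).symm⟩
  · have hb₀_pd : pd3 1 b₀ = fun _ => 0 := by
      funext y
      refine pd3_eq_of_hasDerivAt (hb₀.differentiable (by simp)) ?_
      simpa [hb₀_def] using hasDerivAt_const (y 1) (b (Function.update y 1 0))
    rw [hpd, pd3_coordPrimitive_self ha, pd3_coordPrimitive_of_ne hb₀ (by decide), hb₀_pd]
    simp [coordPrimitive]
  · have hclosed' : pd3 1 b = pd3 0 c + pd3 2 a := by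
      funext y
      have := hclosed y
      simp only [Pi.add_apply]
      linarith
    have hsplit := coordPrimitive_add (continuous_pd3 hc 0) (continuous_pd3 ha 2) 1 x
    rw [← hclosed', coordPrimitive_pd3_self hb] at hsplit
    rw [hpd, pd3_coordPrimitive_self hb₀, pd3_coordPrimitive_of_ne hc (by decide),
      pd3_coordPrimitive_of_ne ha (by decide)]
    simp only [hb₀_def]
    linarith
end
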